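/- arXiv:1901.04113 — 4 statements merged into one kernel-verified Lean document; each statement's English description precedes it below -/
import Mathlib

section
/- Let (R,m) be a Noetherian local domain of prime characteristic p, of Krull dimension 1, with infinite residue field R/m, and let n be a positive integer. Then R is n-tight if and only if R is n-normal. That is: every ideal I and every x ∈ I* admit an equation x^n + a_1·x^{n−1} + ⋯ + a_n = 0 with a_i ∈ I^i, if and only if every element x of the fraction field of R that is integral over R satisfies a monic polynomial equation of degree n with coefficients in R. -/
/-- The `q`-th Frobenius power `I^{[q]}` of an ideal `I`: the ideal generated by
the `q`-th powers of the elements of `I`. -/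
def frobeniusPower {R : Type*} [CommRing R] (I : Ideal R) (q : ℕ) : Ideal R :=
  Ideal.span ((fun a => a ^ q) '' (I : Set R))

/-- `Rreg c` means `c ∈ R^o`, i.e. `c` avoids every minimal prime of `R`. -/
def Rreg {R : Type*} [CommRing R] (c : R) : Prop :=
  ∀ P ∈ minimalPrimes R, c ∉ P

/-- `x` lies in the tight closure `I*` of `I` (characteristic `p`):
there is `c ∈ R^o` with `c * x^(p^e) ∈ I^{[p^e]}` for all `e ≫ 0`. -/
def InTightClosure {R : Type*} [CommRing R] (p : ℕ) (I : Ideal R) (x : R) : Prop :=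
  ∃ c, Rreg c ∧ ∃ N : ℕ, ∀ e ≥ N, c * x ^ p ^ e ∈ frobeniusPower I (p ^ e)

/-- The tight closure `I*` of `I`, as an ideal: the span of the set of elements in the
tight closure (this set is already an ideal, so taking the span is harmless). -/
def tightClosure {R : Type*} [CommRing R] (p : ℕ) (I : Ideal R) : Ideal R :=
  Ideal.span {x | InTightClosure p I x}

/-- The quotient of a one-dimensional Noetherian ring by a nonzero ideal is Artinian. -/
theorem Ring.DimensionLEOne.isArtinianRing_quotient {R : Type*} [CommRing R]
    [IsNoetherianRing R] [Ring.DimensionLEOne R] {I : Ideal R} (hI : I ≠ ⊥) :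
    IsArtinianRing (R ⧸ I) := by
  rw [isArtinianRing_iff_krullDimLE_zero,
    Ideal.krullDimLE_zero_quotient_iff_forall_minimalPrimes_isMaximal]
  exact fun J hJ => hJ.1.1.isMaximal (ne_bot_of_le_ne_bot hI hJ.1.2)

/-- In a one-dimensional Noetherian ring, a descending chain of ideals whose members all contain
a fixed nonzero ideal is eventually constant. -/
theorem Ring.DimensionLEOne.exists_eq_of_antitone {R : Type*} [CommRing R]
    [IsNoetherianRing R] [Ring.DimensionLEOne R] {I : Ideal R} (hI : I ≠ ⊥)
    (f : ℕ → Ideal R) (hf : Antitone f) (hle : ∀ n, I ≤ f n) :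
    ∃ l, ∀ m ≥ l, f l = f m := by
  have := Ring.DimensionLEOne.isArtinianRing_quotient hI
  obtain ⟨l, hl⟩ := IsArtinian.monotone_stabilizes (R := R ⧸ I)
    ⟨fun n => OrderDual.toDual ((f n).map (Ideal.Quotient.mk I)),
      fun a b hab => Ideal.map_mono (hf hab)⟩
  refine ⟨l, fun m hm => ?_⟩
  have key : ∀ n, ((f n).map (Ideal.Quotient.mk I)).comap (Ideal.Quotient.mk I) = f n := by
    intro n
    rw [Ideal.comap_map_of_surjective' _ Ideal.Quotient.mk_surjective, Ideal.mk_ker,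
      sup_eq_left.mpr (hle n)]
  have h : (f l).map (Ideal.Quotient.mk I) = (f m).map (Ideal.Quotient.mk I) := hl m hm
  rw [← key l, ← key m, h]

section KrullAkizuki

variable {R S : Type*} [CommRing R] [IsNoetherianRing R] [Ring.DimensionLEOne R]
  [CommRing S] [IsDomain S] [Algebra R S]

/-- If every element of `S` has a nonzero `R`-multiple in `R`, then some power of a nonzero
`a : R` multiplies `S` into `R + a ^ (l + 1) S`. -/
theorem exists_pow_mul_eq_add_algebraMap
    (hS : ∀ y : S, ∃ d : R, d ≠ 0 ∧ ∃ b, d • y = algebraMap R S b)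
    {a : R} (ha : algebraMap R S a ≠ 0) :
    ∃ l : ℕ, ∀ y : S, ∃ (z : S) (r : R),
      algebraMap R S a ^ l * y = algebraMap R S a ^ (l + 1) * z + algebraMap R S r := by
  have ha0 : a ≠ 0 := fun h => ha (by simp [h])
  let f : ℕ → Ideal R := fun n =>
    (Ideal.span {algebraMap R S a ^ n}).comap (algebraMap R S) ⊔ Ideal.span {a}
  obtain ⟨l, hl⟩ := Ring.DimensionLEOne.exists_eq_of_antitone
    (I := Ideal.span {a}) (by simpa using ha0) f
    (fun m n hmn => sup_le_sup_right (Ideal.comap_mono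
      (Ideal.span_singleton_le_span_singleton.mpr (pow_dvd_pow _ hmn))) _)
    (fun n => le_sup_right)
  have descend : ∀ (k : ℕ) (y : S),
      (∃ (z : S) (r : R), algebraMap R S a ^ (l + k) * y =
        algebraMap R S a ^ (l + k + 1) * z + algebraMap R S r) →
      ∃ (z : S) (r : R),
        algebraMap R S a ^ l * y = algebraMap R S a ^ (l + 1) * z + algebraMap R S r := by
    intro k y
    induction k with
    | zero => exact id
    | succ k ih =>
      rintro ⟨z, r, h⟩
      apply ih
      have hr : r ∈ f (l + k + 1) := by
        refine Ideal.mem_sup_left ?_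
        rw [Ideal.mem_comap, Ideal.mem_span_singleton]
        exact ⟨y - algebraMap R S a * z, by linear_combination -h⟩
      rw [← hl _ (by lia), hl (l + k + 2) (by lia)] at hr
      obtain ⟨s, hs, t, ht, rfl⟩ := Submodule.mem_sup.mp hr
      rw [Ideal.mem_comap, Ideal.mem_span_singleton] at hs
      obtain ⟨w, hw⟩ := hs
      obtain ⟨t, rfl⟩ := Ideal.mem_span_singleton.mp ht
      refine ⟨z + w, t, mul_left_cancel₀ ha ?_⟩
      rw [map_add, map_mul, hw] at h
      linear_combination h
  refine ⟨l, fun y => ?_⟩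
  obtain ⟨d, hd, b, hb⟩ := hS y
  obtain ⟨h, hh⟩ := Ring.DimensionLEOne.exists_eq_of_antitone
    (I := Ideal.span {d}) (by simpa using hd) (fun n => Ideal.span {a ^ n} ⊔ Ideal.span {d})
    (fun m n hmn => sup_le_sup_right
      (Ideal.span_singleton_le_span_singleton.mpr (pow_dvd_pow _ hmn)) _)
    (fun n => le_sup_right)
  have hmem : a ^ (l + h) ∈ Ideal.span {a ^ (l + h + 1)} ⊔ Ideal.span {d} := by
    rw [← hh _ (by lia), hh (l + h) (by lia)]
    exact Ideal.mem_sup_left (Ideal.mem_span_singleton_self _)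
  obtain ⟨s, hs, t, ht, hst⟩ := Submodule.mem_sup.mp hmem
  obtain ⟨u, rfl⟩ := Ideal.mem_span_singleton.mp hs
  obtain ⟨v, rfl⟩ := Ideal.mem_span_singleton.mp ht
  refine descend h y ⟨algebraMap R S u * y, v * b, ?_⟩
  rw [Algebra.smul_def] at hb
  have := congrArg (algebraMap R S) hst
  simp only [map_add, map_mul, map_pow] at this ⊢
  linear_combination (-y) * this + algebraMap R S v * hb

/-- **Krull–Akizuki**, for a birational extension of a one-dimensional Noetherian domain. -/
theorem isNoetherianRing_of_exists_smul_eq_algebraMap [FaithfulSMul R S]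
    (hS : ∀ y : S, ∃ d : R, d ≠ 0 ∧ ∃ b, d • y = algebraMap R S b) :
    IsNoetherianRing S := by
  have hinj : Function.Injective (algebraMap R S) := FaithfulSMul.algebraMap_injective R S
  refine (isNoetherianRing_iff_ideal_fg S).mpr fun J => ?_
  rcases eq_or_ne J ⊥ with rfl | hJ
  · exact Submodule.fg_bot
  obtain ⟨y, hyJ, hy⟩ := Submodule.exists_mem_ne_zero_of_ne_bot hJ
  obtain ⟨d, hd, a, hda⟩ := hS y
  have haJ : algebraMap R S a ∈ J := by
    rw [← hda, Algebra.smul_def]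
    exact J.mul_mem_left _ hyJ
  have ha : algebraMap R S a ≠ 0 := by
    rw [← hda, Algebra.smul_def]
    exact mul_ne_zero ((map_ne_zero_iff _ hinj).mpr hd) hy
  obtain ⟨l, hl⟩ := exists_pow_mul_eq_add_algebraMap hS ha
  obtain ⟨s, hs⟩ := IsNoetherian.noetherian
    ((Ideal.span {algebraMap R S a ^ l} * J).comap (algebraMap R S))
  have hlift : ∀ r : s, ∃ j ∈ J, algebraMap R S a ^ l * j = algebraMap R S r := by
    intro r
    have hr : (r : R) ∈ (Ideal.span {algebraMap R S a ^ l} * J).comap (algebraMap R S) :=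
      hs ▸ Submodule.subset_span r.2
    exact Ideal.mem_span_singleton_mul.mp hr
  choose j hjJ hj using hlift
  have hle : (Ideal.span {algebraMap R S a ^ l} * J).comap (algebraMap R S) ≤
      (Ideal.span {algebraMap R S a ^ l} *
        Ideal.span (Set.range j)).comap (algebraMap R S) := by
    rw [← hs]
    refine Submodule.span_le.mpr fun r hr => ?_
    exact Ideal.mem_span_singleton_mul.mpr
      ⟨j ⟨r, hr⟩, Ideal.subset_span ⟨_, rfl⟩, hj ⟨r, hr⟩⟩
  have hJeq : J = Ideal.span {algebraMap R S a} ⊔ Ideal.span (Set.range j) := by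
    refine le_antisymm (fun x hx => ?_) (sup_le ?_ ?_)
    · obtain ⟨z, r, h⟩ := hl x
      have hr : r ∈ (Ideal.span {algebraMap R S a ^ l} * J).comap (algebraMap R S) :=
        Ideal.mem_span_singleton_mul.mpr
          ⟨x - algebraMap R S a * z, J.sub_mem hx (J.mul_mem_right _ haJ),
            by linear_combination h⟩
      obtain ⟨w, hw, hwr⟩ := Ideal.mem_span_singleton_mul.mp (hle hr)
      have hx' : x = algebraMap R S a * z + w := by
        refine mul_left_cancel₀ (pow_ne_zero l ha) ?_
        linear_combination h - hwr
      rw [hx']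
      exact Submodule.add_mem_sup (Ideal.mem_span_singleton.mpr ⟨z, rfl⟩) hw
    · exact (Ideal.span_singleton_le_iff_mem _).mpr haJ
    · exact Ideal.span_le.mpr (Set.range_subset_iff.mpr hjJ)
  rw [hJeq]
  exact (Submodule.fg_span_singleton _).sup (Submodule.fg_span (Set.finite_range j))

end KrullAkizuki

/-- The integral closure of a one-dimensional Noetherian domain in its fraction field is a
Dedekind domain. -/
theorem integralClosure.isDedekindDomain_of_dimensionLEOne (R K : Type*) [CommRing R] [IsDomain R]
    [IsNoetherianRing R] [Ring.DimensionLEOne R] [Field K] [Algebra R K] [IsFractionRing R K] :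
    IsDedekindDomain (integralClosure R K) := by
  have hinj : Function.Injective (algebraMap R (integralClosure R K)) := fun x y h =>
    IsFractionRing.injective R K (congrArg Subtype.val h)
  have : FaithfulSMul R (integralClosure R K) :=
    (faithfulSMul_iff_algebraMap_injective R _).mpr hinj
  have : IsNoetherianRing (integralClosure R K) := by
    refine isNoetherianRing_of_exists_smul_eq_algebraMap (R := R) fun y => ?_
    obtain ⟨b, d, hd, hbd⟩ := IsFractionRing.div_surjective (A := R) (y : K)
    have hd0 := nonZeroDivisors.ne_zero hd
    have hd' : algebraMap R K d ≠ 0 := (map_ne_zero_iff _ (IsFractionRing.injective R K)).mpr hd0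
    refine ⟨d, hd0, b, Subtype.ext ?_⟩
    change d • (y : K) = algebraMap R K b
    rw [← hbd, Algebra.smul_def, mul_div_cancel₀ _ hd']
  have : Algebra.IsAlgebraic R K := IsLocalization.isAlgebraic K (nonZeroDivisors R)
  have : IsFractionRing (integralClosure R K) K :=
    integralClosure.isFractionRing_of_algebraic
      (fun x hx => (map_eq_zero_iff _ (IsFractionRing.injective R K)).mp hx)
  have : IsIntegrallyClosed (integralClosure R K) :=
    (isIntegrallyClosed_iff K).mpr fun {x} hx =>
      ⟨⟨x, isIntegral_trans (R := R) x hx⟩, rfl⟩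
  have : IsDedekindRing (integralClosure R K) := { }
  exact { }

/-- A module over a local ring with infinite residue field is not a finite union of proper
submodules. -/
theorem IsLocalRing.exists_forall_notMem_of_ne_top {R M ι : Type*} [CommRing R] [IsLocalRing R]
    [Infinite (IsLocalRing.ResidueField R)] [AddCommGroup M] [Module R M] [Finite ι]
    (N : ι → Submodule R M) (hN : ∀ i, N i ≠ ⊤) : ∃ x, ∀ i, x ∉ N i := by
  cases nonempty_fintype ι
  by_contra! hcover
  obtain ⟨i, -, hi⟩ := Submodule.exists_finiteIndex_of_cover (p := N) (s := Finset.univ)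
    (by ext x; simpa using hcover x)
  have hfin : Finite (M ⧸ N i) := AddSubgroup.finite_quotient_of_finiteIndex
  obtain ⟨x, hx⟩ : ∃ x, x ∉ N i := by
    by_contra! h
    exact hN i ((Submodule.eq_top_iff').mpr h)
  obtain ⟨s, hs⟩ := (IsLocalRing.residue_surjective (R := R)).hasRightInverse
  obtain ⟨u, v, huv, h⟩ := Finite.exists_ne_map_eq_of_infinite
    (fun u : IsLocalRing.ResidueField R => (N i).mkQ (s u • x))
  have hmem : (s u - s v) • x ∈ N i := by
    rw [sub_smul]
    exact (Submodule.Quotient.eq _).mp h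
  have hunit : IsUnit (s u - s v) := by
    rw [← IsLocalRing.residue_ne_zero_iff_isUnit, map_sub, hs u, hs v]
    exact sub_ne_zero.mpr huv
  exact hx (((N i).smul_mem_iff_of_isUnit hunit).mp hmem)

/-- If `S` is a Dedekind domain integral over a local ring `R` with infinite residue field, then
every nonzero ideal of `R` contains an element generating its extension to `S`. -/
theorem Ideal.exists_mem_map_eq_span_singleton {R S : Type*} [CommRing R] [IsDomain R]
    [IsLocalRing R] [Infinite (IsLocalRing.ResidueField R)] [CommRing S] [IsDedekindDomain S]
    [Algebra R S] [FaithfulSMul R S] [Algebra.IsIntegral R S] (hR : ¬ IsField R)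
    {I : Ideal R} (hI : I ≠ ⊥) :
    ∃ b ∈ I, I.map (algebraMap R S) = Ideal.span {algebraMap R S b} := by
  have hinj : Function.Injective (algebraMap R S) := FaithfulSMul.algebraMap_injective R S
  set J := I.map (algebraMap R S) with hJ
  have hJ0 : J ≠ ⊥ := fun h => hI ((Ideal.map_eq_bot_iff_of_injective hinj).mp h)
  obtain ⟨a, ham, ha⟩ := Submodule.exists_mem_ne_zero_of_ne_bot
    (mt IsLocalRing.isField_iff_maximalIdeal_eq.mpr hR)
  have ha' : algebraMap R S a ≠ 0 := (map_ne_zero_iff _ hinj).mpr ha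
  have haQ : ∀ Q : Ideal S, Q.IsMaximal → algebraMap R S a ∈ Q := by
    intro Q hQ
    have hc : (Q.comap (algebraMap R S)).IsMaximal :=
      Ideal.isMaximal_comap_of_isIntegral_of_isMaximal Q
    rw [← IsLocalRing.eq_maximalIdeal hc] at ham
    exact ham
  have hfin : Finite (IsDedekindDomain.HeightOneSpectrum S) := by
    refine Set.finite_univ_iff.mp ((Ideal.finite_factors
      (I := Ideal.span {algebraMap R S a}) (by simpa using ha')).subset fun v _ => ?_)
    exact Ideal.dvd_span_singleton.mpr (haQ _ v.isMaximal)
  obtain ⟨⟨b, hbI⟩, hb⟩ := IsLocalRing.exists_forall_notMem_of_ne_top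
    (fun v : IsDedekindDomain.HeightOneSpectrum S =>
      Submodule.comap I.subtype ((J * v.asIdeal).comap (algebraMap R S))) (by
    intro v hv
    have hle : J ≤ J * v.asIdeal := Ideal.map_le_iff_le_comap.mpr fun x hx => by
      have : (⟨x, hx⟩ : I) ∈
          Submodule.comap I.subtype ((J * v.asIdeal).comap (algebraMap R S)) :=
        hv ▸ Submodule.mem_top
      exact this
    have heq : J * v.asIdeal = J * ⊤ := by
      rw [Ideal.mul_top]
      exact le_antisymm Ideal.mul_le_left hle
    exact v.isPrime.ne_top (mul_left_cancel₀ hJ0 heq))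
  refine ⟨b, hbI, ?_⟩
  have hdvd : J ∣ Ideal.span {algebraMap R S b} :=
    Ideal.dvd_span_singleton.mpr (Ideal.mem_map_of_mem _ hbI)
  obtain ⟨L, hL⟩ := hdvd
  rcases eq_or_ne L ⊤ with rfl | hLtop
  · rw [hL, Ideal.mul_top]
  obtain ⟨Q, hQ, hLQ⟩ := Ideal.exists_le_maximal L hLtop
  have hQ0 : Q ≠ ⊥ := fun h => ha' (by simpa [h] using haQ Q hQ)
  refine absurd ?_ (hb ⟨Q, hQ.isPrime, hQ0⟩)
  have hmem : algebraMap R S b ∈ J * L := hL ▸ Ideal.mem_span_singleton_self _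
  exact Ideal.mul_mono_right hLQ hmem

/-- A weak form of complete integral closedness: it suffices to bound denominators along the
`q`-th powers for a cofinal set of exponents `q`. -/
theorem isIntegral_of_frequently_isIntegral_mul_pow {R K : Type*} [CommRing R] [IsDomain R]
    [Field K] [Algebra R K] [IsFractionRing R K] [IsNoetherianRing (integralClosure R K)]
    {c : R} (hc : c ≠ 0) {y : K}
    (h : ∀ m : ℕ, ∃ q > m, IsIntegral R (algebraMap R K c * y ^ q)) : IsIntegral R y := by
  have hc' : algebraMap R K c ≠ 0 := (map_ne_zero_iff _ (IsFractionRing.injective R K)).mpr hc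
  have hint : ∀ m : ℕ, IsIntegral R (algebraMap R K c * y ^ m) := by
    intro m
    obtain ⟨q, hq, hcq⟩ := h m
    refine IsIntegral.of_pow (n := q) (by lia) ?_
    obtain ⟨k, rfl⟩ := Nat.exists_eq_add_of_lt hq
    have : (algebraMap R K c * y ^ m) ^ (m + k + 1) =
        algebraMap R K (c ^ (k + 1)) * (algebraMap R K c * y ^ (m + k + 1)) ^ m := by
      rw [map_pow]
      ring
    rw [this]
    exact isIntegral_algebraMap.mul (hcq.pow m)
  have halmost : IsAlmostIntegral (integralClosure R K) y := by
    refine ⟨⟨algebraMap R K c, isIntegral_algebraMap⟩,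
      mem_nonZeroDivisors_of_ne_zero fun h0 => hc' (congrArg Subtype.val h0), fun m => ?_⟩
    exact ⟨⟨_, hint m⟩, rfl⟩
  have := halmost.isIntegral
  exact isIntegral_trans (R := R) y this

theorem rreg_iff_ne_zero {R : Type*} [CommRing R] [IsDomain R] {c : R} : Rreg c ↔ c ≠ 0 := by
  simp [Rreg, IsDomain.minimalPrimes_eq_singleton_bot]

theorem frobeniusPower_span_singleton {R : Type*} [CommRing R] (b : R) (q : ℕ) :
    frobeniusPower (Ideal.span {b}) q = Ideal.span {b ^ q} := by
  refine le_antisymm (Ideal.span_le.mpr ?_)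
    ((Ideal.span_singleton_le_iff_mem _).mpr
      (Ideal.subset_span ⟨b, Ideal.mem_span_singleton_self b, rfl⟩))
  rintro _ ⟨x, hx, rfl⟩
  exact Ideal.mem_span_singleton.mpr (pow_dvd_pow_of_dvd (Ideal.mem_span_singleton.mp hx) q)

theorem map_frobeniusPower_le {R S : Type*} [CommRing R] [CommRing S] (f : R →+* S)
    (I : Ideal R) (q : ℕ) : (frobeniusPower I q).map f ≤ frobeniusPower (I.map f) q := by
  refine Ideal.map_le_iff_le_comap.mpr (Ideal.span_le.mpr ?_)
  rintro _ ⟨x, hx, rfl⟩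
  exact Ideal.subset_span ⟨f x, Ideal.mem_map_of_mem f hx, (map_pow f x q).symm⟩

/-- If `x / b` is integral over `R`, then `x` is in the tight closure of `(b)`. -/
theorem inTightClosure_span_singleton {R K : Type*} [CommRing R] [IsDomain R] [Field K]
    [Algebra R K] [IsFractionRing R K] (p : ℕ) {x b : R} (hb : b ≠ 0)
    (h : IsIntegral R (algebraMap R K x / algebraMap R K b)) :
    InTightClosure p (Ideal.span {b}) x := by
  have hb' : algebraMap R K b ≠ 0 := (map_ne_zero_iff _ (IsFractionRing.injective R K)).mpr hb
  obtain ⟨c, hc, hcm⟩ := h.isAlmostIntegral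
  refine ⟨c, rreg_iff_ne_zero.mpr (nonZeroDivisors.ne_zero hc), 0, fun e _ => ?_⟩
  obtain ⟨r, hr⟩ := hcm (p ^ e)
  rw [frobeniusPower_span_singleton, Ideal.mem_span_singleton]
  refine ⟨r, IsFractionRing.injective R K ?_⟩
  rw [Algebra.smul_def, div_pow] at hr
  simp only [map_mul, map_pow, hr]
  field_simp

/-- In a one-dimensional Noetherian local domain with infinite residue field, every nonzero ideal
`I` has an element `b` such that `x / b` is integral for all `x` in the tight closure of `I`. -/
theorem exists_mem_forall_inTightClosure_isIntegral_div {R : Type*} (K : Type*) [CommRing R]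
    [IsDomain R] [IsNoetherianRing R] [IsLocalRing R] [Ring.DimensionLEOne R]
    [Infinite (IsLocalRing.ResidueField R)] [Field K] [Algebra R K] [IsFractionRing R K]
    {p : ℕ} (hp : 1 < p) (hR : ¬ IsField R) {I : Ideal R} (hI : I ≠ ⊥) :
    ∃ b ∈ I, b ≠ 0 ∧
      ∀ x, InTightClosure p I x → IsIntegral R (algebraMap R K x / algebraMap R K b) := by
  have := integralClosure.isDedekindDomain_of_dimensionLEOne R K
  have hinj : Function.Injective (algebraMap R (integralClosure R K)) := fun x y h =>
    IsFractionRing.injective R K (congrArg Subtype.val h)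
  have : FaithfulSMul R (integralClosure R K) :=
    (faithfulSMul_iff_algebraMap_injective R _).mpr hinj
  obtain ⟨b, hbI, hb⟩ := Ideal.exists_mem_map_eq_span_singleton
    (S := integralClosure R K) hR hI
  have hb0 : b ≠ 0 := by
    rintro rfl
    exact hI ((Ideal.map_eq_bot_iff_of_injective hinj).mp (by simpa using hb))
  have hb' : algebraMap R K b ≠ 0 := (map_ne_zero_iff _ (IsFractionRing.injective R K)).mpr hb0
  refine ⟨b, hbI, hb0, fun x hx => ?_⟩
  obtain ⟨c, hc, N, hcN⟩ := hx
  refine isIntegral_of_frequently_isIntegral_mul_pow (rreg_iff_ne_zero.mp hc) fun m =>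
    ⟨p ^ (m + N), (Nat.lt_pow_self hp).trans_le (Nat.pow_le_pow_right (by lia) (by lia)), ?_⟩
  have hmem := map_frobeniusPower_le (algebraMap R (integralClosure R K)) I _
    (Ideal.mem_map_of_mem _ (hcN (m + N) (by lia)))
  rw [hb, frobeniusPower_span_singleton, Ideal.mem_span_singleton] at hmem
  obtain ⟨z, hz⟩ := hmem
  have hzK : algebraMap R K (c * x ^ p ^ (m + N)) = algebraMap R K b ^ p ^ (m + N) * (z : K) :=
    congrArg Subtype.val hz
  have hz' : algebraMap R K c * (algebraMap R K x / algebraMap R K b) ^ p ^ (m + N) = (z : K) := by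
    rw [map_mul, map_pow] at hzK
    rw [div_pow, ← mul_div_assoc, hzK, mul_div_cancel_left₀ _ (pow_ne_zero _ hb')]
  rw [hz']
  exact z.2

/-- Splitting off the leading term of a monic polynomial, indexing the remaining coefficients by
codegree. -/
theorem Polynomial.Monic.aeval_eq_pow_add_sum_Icc {R A : Type*} [CommRing R] [CommRing A]
    [Algebra R A] {f : Polynomial R} (hf : f.Monic) (y : A) :
    Polynomial.aeval y f = y ^ f.natDegree + ∑ i ∈ Finset.Icc 1 f.natDegree,
      algebraMap R A (f.coeff (f.natDegree - i)) * y ^ (f.natDegree - i) := by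
  rw [Polynomial.aeval_eq_sum_range, Finset.sum_range_succ, hf.coeff_natDegree, one_smul, add_comm]
  congr 1
  refine Finset.sum_nbij' (fun i => f.natDegree - i) (fun i => f.natDegree - i) ?_ ?_ ?_ ?_ ?_
  · intro i hi
    simp only [Finset.mem_range, Finset.mem_Icc] at *
    lia
  · intro i hi
    simp only [Finset.mem_range, Finset.mem_Icc] at *
    lia
  · intro i hi
    simp only [Finset.mem_range] at hi
    lia
  · intro i hi
    simp only [Finset.mem_Icc] at hi
    lia
  · intro i hi
    simp only [Finset.mem_range] at hi
    rw [Nat.sub_sub_self hi.le, Algebra.smul_def]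

/-- The monic polynomial with prescribed coefficients indexed by codegree. -/
theorem Polynomial.exists_monic_aeval_eq_pow_add_sum_Icc {R : Type*} [CommRing R] [Nontrivial R]
    (c : ℕ → R) (n : ℕ) : ∃ f : Polynomial R, f.Monic ∧ f.natDegree = n ∧
      ∀ {A : Type*} [CommRing A] [Algebra R A] (y : A), Polynomial.aeval y f =
        y ^ n + ∑ i ∈ Finset.Icc 1 n, algebraMap R A (c i) * y ^ (n - i) := by
  have hdeg : (∑ i ∈ Finset.Icc 1 n,
      Polynomial.C (c i) * Polynomial.X ^ (n - i)).degree < (n : WithBot ℕ) := by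
    refine (Polynomial.degree_sum_le _ _).trans_lt
      ((Finset.sup_lt_iff (WithBot.bot_lt_coe n)).mpr fun i hi => ?_)
    refine (Polynomial.degree_C_mul_X_pow_le _ _).trans_lt ?_
    simp only [Finset.mem_Icc] at hi
    exact Nat.cast_lt.mpr (by lia)
  refine ⟨_, Polynomial.monic_X_pow_add hdeg, ?_, fun y => by simp⟩
  refine Polynomial.natDegree_eq_of_degree_eq_some ?_
  rw [Polynomial.degree_add_eq_left_of_degree_lt, Polynomial.degree_X_pow]
  rwa [Polynomial.degree_X_pow]

/-- A one-dimensional Noetherian local domain of characteristic `p` with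
infinite residue field is `n`-tight iff it is `n`-normal. -/
theorem n_tight_iff_n_normal {R : Type*} [CommRing R] [IsDomain R] [IsNoetherianRing R]
    [IsLocalRing R] (p : ℕ) [Fact p.Prime] [CharP R p]
    (hdim : ringKrullDim R = 1)
    [Infinite (IsLocalRing.ResidueField R)]
    (n : ℕ) (hn : 1 ≤ n) :
    (∀ I : Ideal R, ∀ x : R, InTightClosure p I x →
        ∃ a : ℕ → R, (∀ i, 1 ≤ i → i ≤ n → a i ∈ I ^ i) ∧
          x ^ n + ∑ i ∈ Finset.Icc 1 n, a i * x ^ (n - i) = 0) ↔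
      (∀ x : FractionRing R, IsIntegral R x →
        ∃ f : Polynomial R, f.Monic ∧ f.natDegree = n ∧ Polynomial.aeval x f = 0) := by
  have hp : 1 < p := (Fact.out : p.Prime).one_lt
  have hR : ¬ IsField R := fun h => by
    simp [ringKrullDim_eq_zero_of_isField h] at hdim
  have : Ring.DimensionLEOne R := by
    have : Ring.KrullDimLE 1 R := (Order.krullDimLE_iff _ _).mpr hdim.le
    exact ⟨fun hP hP' => hP'.isMaximal_of_ne_bot hP⟩
  have hinj := IsFractionRing.injective R (FractionRing R)
  constructor
  · intro h y hy
    obtain ⟨x, b, hb, rfl⟩ := IsFractionRing.div_surjective (A := R) y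
    have hb0 := nonZeroDivisors.ne_zero hb
    have hb' : algebraMap R (FractionRing R) b ≠ 0 := (map_ne_zero_iff _ hinj).mpr hb0
    obtain ⟨a, ha, hax⟩ := h _ x (inTightClosure_span_singleton p hb0 hy)
    have hc : ∀ i, ∃ c, i ∈ Finset.Icc 1 n → a i = b ^ i * c := by
      intro i
      by_cases hi : i ∈ Finset.Icc 1 n
      · obtain ⟨h1, h2⟩ := Finset.mem_Icc.mp hi
        have := ha i h1 h2
        rw [Ideal.span_singleton_pow, Ideal.mem_span_singleton] at this
        exact this.imp fun c hc _ => hc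
      · exact ⟨0, fun h => absurd h hi⟩
    choose c hc using hc
    obtain ⟨f, hf, hfn, hfy⟩ := Polynomial.exists_monic_aeval_eq_pow_add_sum_Icc c n
    refine ⟨f, hf, hfn, (mul_eq_zero.mp ?_).resolve_left (pow_ne_zero n hb')⟩
    rw [hfy, ← map_zero (algebraMap R (FractionRing R)), ← hax, map_add, map_sum, mul_add,
      Finset.mul_sum, map_pow, ← mul_pow, mul_div_cancel₀ _ hb']
    congr 1
    refine Finset.sum_congr rfl fun i hi => ?_
    obtain ⟨k, rfl⟩ := Nat.exists_eq_add_of_le (Finset.mem_Icc.mp hi).2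
    rw [hc i hi, Nat.add_sub_cancel_left, div_pow, map_mul, map_mul, map_pow, map_pow]
    field_simp
    ring
  · intro h I x hx
    rcases eq_or_ne I ⊥ with rfl | hI
    · refine ⟨0, fun i _ _ => Ideal.zero_mem _, ?_⟩
      obtain ⟨c, hc, N, hN⟩ := hx
      have h0 := hN N le_rfl
      rw [← Ideal.span_singleton_zero, frobeniusPower_span_singleton,
        zero_pow (pow_ne_zero _ (by lia)), Ideal.span_singleton_zero, Ideal.mem_bot] at h0
      have hx0 : x = 0 :=
        eq_zero_of_pow_eq_zero ((mul_eq_zero.mp h0).resolve_left (rreg_iff_ne_zero.mp hc))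
      simp [hx0, show n ≠ 0 by lia]
    · obtain ⟨b, hbI, hb0, hb⟩ :=
        exists_mem_forall_inTightClosure_isIntegral_div (FractionRing R) hp hR hI
      have hb' : algebraMap R (FractionRing R) b ≠ 0 := (map_ne_zero_iff _ hinj).mpr hb0
      obtain ⟨f, hf, rfl, hfy⟩ := h _ (hb x hx)
      refine ⟨fun i => f.coeff (f.natDegree - i) * b ^ i,
        fun i _ _ => Ideal.mul_mem_left _ _ (Ideal.pow_mem_pow hbI i), hinj ?_⟩
      rw [map_zero, ← mul_zero (algebraMap R (FractionRing R) b ^ f.natDegree), ← hfy,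
        hf.aeval_eq_pow_add_sum_Icc, map_add, map_sum, mul_add, Finset.mul_sum, map_pow,
        ← mul_pow, mul_div_cancel₀ _ hb']
      congr 1
      refine Finset.sum_congr rfl fun i hi => ?_
      obtain ⟨k, hk⟩ := Nat.exists_eq_add_of_le (Finset.mem_Icc.mp hi).2
      simp only [hk, Nat.add_sub_cancel_left, div_pow, map_mul, map_pow]
      field_simp
      ring
end

section
/- Let (R,m) be a Noetherian local ring of prime characteristic p which is Cohen–Macaulay and not regular, and suppose the maximal ideal m is a strong test ideal, i.e., m·(I*) = m·I for every ideal I (this holds, by Vraciu's theorem, when R is Gorenstein F-finite with test ideal equal to m). Let J be an ideal generated by a system of parameters such that the R-module (J :_R m)/J has length 1 (as is the case when R is Gorenstein). Then for every x ∈ J*, one has x² ∈ J·x + J². -/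
/-- `R` is Cohen–Macaulay: there is a regular sequence inside the maximal ideal whose
length equals the Krull dimension of `R`. -/
def IsCMLocal (R : Type*) [CommRing R] [IsLocalRing R] : Prop :=
  ∃ rs : List R, (∀ r ∈ rs, r ∈ IsLocalRing.maximalIdeal R) ∧
    RingTheory.Sequence.IsRegular R rs ∧ (rs.length : WithBot (WithTop ℕ)) = ringKrullDim R

/-- `R` is a regular local ring: the maximal ideal is generated by `dim R` elements. -/
def IsRegLocal (R : Type*) [CommRing R] [IsLocalRing R] : Prop :=
  ∃ s : Finset R, (s.card : WithBot (WithTop ℕ)) = ringKrullDim R ∧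
    Ideal.span (s : Set R) = IsLocalRing.maximalIdeal R

/-- `J` is generated by a system of parameters: `J` is generated by `dim R` elements and
is `m`-primary (equivalently, for a Noetherian local ring, `√J = m`). -/
def IsSOPIdeal {R : Type*} [CommRing R] [IsLocalRing R] (J : Ideal R) : Prop :=
  (∃ s : Finset R, (s.card : WithBot (WithTop ℕ)) = ringKrullDim R ∧
    Ideal.span (s : Set R) = J) ∧ J.radical = IsLocalRing.maximalIdeal R

section CohenMacaulay

open RingTheory.Sequence IsLocalRing Pointwise

universe u

theorem ringKrullDim_quotient_succ_le_of_lt {R : Type*} [CommRing R] {P Q : Ideal R}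
    [P.IsPrime] (hPQ : P < Q) :
    ringKrullDim (R ⧸ Q) + 1 ≤ ringKrullDim (R ⧸ P) := by
  obtain ⟨x, hxQ, hxP⟩ := SetLike.exists_of_lt hPQ
  have hx : Ideal.Quotient.mk P x ∈ nonZeroDivisors (R ⧸ P) :=
    mem_nonZeroDivisors_of_ne_zero fun h => hxP (Ideal.Quotient.eq_zero_iff_mem.mp h)
  refine le_trans ?_ (ringKrullDim_quotient_succ_le_of_nonZeroDivisor hx)
  gcongr
  refine ringKrullDim_le_of_surjective
    (Ideal.Quotient.lift _ (Ideal.Quotient.factor hPQ.le) fun a ha => ?_)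
    (Ideal.Quotient.lift_surjective_of_surjective _ _ (Ideal.Quotient.factor_surjective hPQ.le))
  have hle : Ideal.span {Ideal.Quotient.mk P x} ≤
      RingHom.ker (Ideal.Quotient.factor hPQ.le) := by
    rw [Ideal.span_singleton_le_iff_mem, RingHom.mem_ker, Ideal.Quotient.factor_mk]
    exact Ideal.Quotient.eq_zero_iff_mem.mpr hxQ
  exact hle ha

/-- An associated prime of `M` is strictly contained in an associated prime of `M ⧸ xM`
when `x` is an `M`-regular element of the maximal ideal. -/
theorem exists_isAssociatedPrime_quotSMulTop_gt {R M : Type*} [CommRing R] [IsNoetherianRing R]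
    [IsLocalRing R] [AddCommGroup M] [Module R M] [Module.Finite R M] {x : R}
    (hx : x ∈ maximalIdeal R) (reg : IsSMulRegular M x) {P : Ideal R}
    (hP : IsAssociatedPrime P M) :
    ∃ Q, IsAssociatedPrime Q (QuotSMulTop x M) ∧ P < Q := by
  obtain ⟨hprime, y, rfl⟩ := isAssociatedPrime_iff.mp hP
  set P := (⊥ : Submodule R M).colon {y} with hPdef
  have hy : y ≠ 0 := by
    rintro rfl
    exact hprime.ne_top (by simp [hPdef])
  let N : Submodule R M := Submodule.torsionBySet R M (P : Set R)
  have hmemN : ∀ z, z ∈ N ↔ ∀ a ∈ P, a • z = 0 := fun z => by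
    simp [N, Submodule.mem_torsionBySet_iff]
  have hyN : y ∈ N := (hmemN y).2 fun a ha => by
    simpa using Submodule.mem_colon_singleton.mp ha
  have hex : ∃ z ∈ N, z ∉ x • (⊤ : Submodule R M) := by
    by_contra! hall
    refine hy ((Submodule.mem_bot R).mp ?_)
    rw [← Submodule.eq_bot_of_le_smul_of_le_jacobson_bot (Ideal.span {x}) N
      (IsNoetherian.noetherian N) ?_ ?_]
    · exact hyN
    · intro z hz
      obtain ⟨w, -, rfl⟩ := (Submodule.mem_smul_pointwise_iff_exists _ _ _).mp (hall z hz)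
      refine Submodule.smul_mem_smul (Ideal.mem_span_singleton_self x) ((hmemN w).2 fun a ha => ?_)
      refine reg.right_eq_zero_of_smul ?_
      rw [smul_comm]
      exact (hmemN _).1 hz a ha
    · rw [Ideal.span_singleton_le_iff_mem, jacobson_eq_maximalIdeal _ bot_ne_top]
      exact hx
  obtain ⟨z, hzN, hz⟩ := hex
  let z' : QuotSMulTop x M := Submodule.Quotient.mk z
  have hz' : z' ≠ 0 := fun h => hz ((Submodule.Quotient.mk_eq_zero _).mp h)
  obtain ⟨Q, hQ, hle⟩ := exists_le_isAssociatedPrime_of_isNoetherianRing R z' hz'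
  refine ⟨Q, hQ, SetLike.lt_iff_le_and_exists.mpr ⟨fun a ha => hle ?_, x, hle ?_, ?_⟩⟩
  · rw [Submodule.mem_colon_singleton, Submodule.mem_bot, ← Submodule.Quotient.mk_smul,
      (hmemN z).1 hzN a ha, Submodule.Quotient.mk_zero]
  · rw [Submodule.mem_colon_singleton, Submodule.mem_bot, ← Submodule.Quotient.mk_smul,
      Submodule.Quotient.mk_eq_zero]
    exact Submodule.smul_mem_pointwise_smul _ _ _ trivial
  · intro hxP
    rw [hPdef, Submodule.mem_colon_singleton, Submodule.mem_bot] at hxP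
    exact hy (reg.right_eq_zero_of_smul hxP)

/-- The depth of `M` is at most `dim R ⧸ P` for every associated prime `P` of `M`. -/
theorem length_le_ringKrullDim_quotient_of_isAssociatedPrime {R M : Type*} [CommRing R]
    [IsNoetherianRing R] [IsLocalRing R] [AddCommGroup M] [Module R M] [Module.Finite R M]
    {rs : List R} (hmem : ∀ r ∈ rs, r ∈ maximalIdeal R) (reg : IsRegular M rs)
    {P : Ideal R} (hP : IsAssociatedPrime P M) :
    (rs.length : WithBot ℕ∞) ≤ ringKrullDim (R ⧸ P) := by
  have := hP.isPrime
  induction rs generalizing M P with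
  | nil => simpa using ringKrullDim_nonneg_of_nontrivial
  | cons r rs ih =>
    rw [isRegular_cons_iff] at reg
    obtain ⟨Q, hQ, hPQ⟩ := exists_isAssociatedPrime_quotSMulTop_gt
      (hmem r List.mem_cons_self) reg.1 hP
    refine le_trans ?_ (ringKrullDim_quotient_succ_le_of_lt hPQ)
    rw [List.length_cons, Nat.cast_add, Nat.cast_one]
    gcongr
    exact ih (fun r hr => hmem r (List.mem_cons_of_mem _ hr)) reg.2 hQ hQ.isPrime

open CategoryTheory Abelian in
/-- The depth of a module drops by at most one modulo a regular element. -/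
theorem exists_isRegular_quotSMulTop {R M : Type u} [CommRing R] [IsNoetherianRing R]
    [IsLocalRing R] [AddCommGroup M] [Module R M] [Module.Finite R M] [Nontrivial M] {x : R}
    (hx : x ∈ maximalIdeal R) (hreg : IsSMulRegular M x) {n : ℕ}
    (h : ∃ rs : List R, rs.length = n + 1 ∧ (∀ r ∈ rs, r ∈ maximalIdeal R) ∧ IsRegular M rs) :
    ∃ rs : List R, rs.length = n ∧ (∀ r ∈ rs, r ∈ maximalIdeal R) ∧
      IsRegular (QuotSMulTop x M) rs := by
  have hlt : ∀ (N : Type u) [AddCommGroup N] [Module R N] [Module.Finite R N] [Nontrivial N],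
      maximalIdeal R • (⊤ : Submodule R N) < ⊤ := fun N _ _ _ _ =>
    (Submodule.top_ne_ideal_smul_of_le_jacobson_annihilator
      (maximalIdeal_le_jacobson _)).symm.lt_top
  have : Nontrivial (QuotSMulTop x M) := nontrivial_quotSMulTop_of_mem_maximalIdeal M hx
  have hM := ((ModuleCat.exists_isRegular_tfae (maximalIdeal R) (n + 1) (ModuleCat.of R M)
    (hlt M)).out 3 1).mp h
  refine ((ModuleCat.exists_isRegular_tfae (maximalIdeal R) n (ModuleCat.of R (QuotSMulTop x M))
    (hlt _)).out 1 3).mp fun i hi => ?_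
  have zero1 := AddCommGrpCat.isZero_of_iff_subsingleton.mpr (hM i (by omega))
  have zero2 := AddCommGrpCat.isZero_of_iff_subsingleton.mpr (hM (i + 1) (by omega))
  have hreg' : IsSMulRegular (ModuleCat.of R M) x := hreg
  exact AddCommGrpCat.subsingleton_of_isZero <| ShortComplex.Exact.isZero_of_both_zeros
    ((Ext.covariant_sequence_exact₃' _ hreg'.smulShortComplex_shortExact) i (i + 1) rfl)
    (zero1.eq_zero_of_src _) (zero2.eq_zero_of_tgt _)

theorem ringKrullDim_quotient_le_length {R : Type*} [CommRing R] [IsNoetherianRing R]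
    [IsLocalRing R] {P : Ideal R} [P.IsPrime] {as : List R}
    (h : maximalIdeal R ≤ (P ⊔ Ideal.ofList as).radical) (hP : Ideal.ofList as ≤ maximalIdeal R) :
    ringKrullDim (R ⧸ P) ≤ as.length := by
  classical
  have : Nontrivial (R ⧸ P) := Ideal.Quotient.nontrivial_iff.mpr (Ideal.IsPrime.ne_top ‹_›)
  have : IsLocalRing (R ⧸ P) :=
    .of_surjective' (Ideal.Quotient.mk P) Ideal.Quotient.mk_surjective
  have hcomap : (maximalIdeal (R ⧸ P)).comap (Ideal.Quotient.mk P) = maximalIdeal R :=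
    IsLocalRing.eq_maximalIdeal
      (Ideal.comap_isMaximal_of_surjective _ Ideal.Quotient.mk_surjective)
  have hmin : maximalIdeal (R ⧸ P) ∈
      (Ideal.span ((as.map (Ideal.Quotient.mk P)).toFinset : Set (R ⧸ P))).minimalPrimes := by
    refine ⟨⟨inferInstance, ?_⟩, fun q hq _ => ?_⟩
    · rw [Ideal.span_le]
      intro b hb
      simp only [List.coe_toFinset, List.mem_map, Set.mem_ofPred_eq] at hb
      obtain ⟨a, ha, rfl⟩ := hb
      have : a ∈ maximalIdeal R := hP (Ideal.subset_span ha)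
      rwa [← hcomap] at this
    · have := hq.1
      rw [← Ideal.comap_le_comap_iff_of_surjective _ Ideal.Quotient.mk_surjective, hcomap]
      refine h.trans ((Ideal.IsPrime.radical_le_iff inferInstance).mpr (sup_le ?_ ?_))
      · intro a ha
        rw [Ideal.mem_comap, Ideal.Quotient.eq_zero_iff_mem.mpr ha]
        exact q.zero_mem
      · refine Ideal.span_le.mpr fun a ha => hq.2 (Ideal.subset_span ?_)
        simpa using ⟨a, ha, rfl⟩
  rw [← maximalIdeal_height_eq_ringKrullDim]
  have h1 := Ideal.height_le_card_of_mem_minimalPrimes_span_finset hmin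
  have h2 : (as.map (Ideal.Quotient.mk P)).toFinset.card ≤ as.length := by
    simpa using List.toFinset_card_le (as.map (Ideal.Quotient.mk P))
  have h3 : (maximalIdeal (R ⧸ P)).height ≤ (as.length : ℕ∞) :=
    h1.trans (by exact_mod_cast h2)
  exact_mod_cast h3

/-- A system of parameters of a Cohen–Macaulay module is a regular sequence. -/
theorem isWeaklyRegular_of_maximalIdeal_le_radical {R M : Type u} [CommRing R]
    [IsNoetherianRing R] [IsLocalRing R] [AddCommGroup M] [Module R M] [Module.Finite R M]
    [Nontrivial M] {as : List R} (has : ∀ a ∈ as, a ∈ maximalIdeal R)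
    (hrad : maximalIdeal R ≤ (Module.annihilator R M ⊔ Ideal.ofList as).radical)
    (h : ∃ rs : List R, rs.length = as.length ∧ (∀ r ∈ rs, r ∈ maximalIdeal R) ∧
      IsRegular M rs) :
    IsWeaklyRegular M as := by
  induction as generalizing M with
  | nil => exact .nil R M
  | cons a as ih =>
    have ha := has a List.mem_cons_self
    have has' : ∀ b ∈ as, b ∈ maximalIdeal R := fun b hb => has b (List.mem_cons_of_mem _ hb)
    have hreg : IsSMulRegular M a := by
      by_contra hna
      have : a ∈ ⋃ P ∈ associatedPrimes R M, (P : Set R) := by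
        rw [biUnion_associatedPrimes_eq_compl_regular]
        exact hna
      simp only [Set.mem_iUnion] at this
      obtain ⟨P, hP, haP⟩ := this
      have := hP.1
      obtain ⟨rs, hlen, hrs, hreg⟩ := h
      have h1 := length_le_ringKrullDim_quotient_of_isAssociatedPrime hrs hreg hP
      have h2 : ringKrullDim (R ⧸ P) ≤ as.length := by
        refine ringKrullDim_quotient_le_length (hrad.trans (Ideal.radical_mono ?_))
          (Ideal.span_le.mpr has')
        rw [Ideal.ofList_cons]
        refine sup_le (le_sup_of_le_left ?_) (sup_le (le_sup_of_le_left ?_) le_sup_right)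
        · exact Submodule.annihilator_top.symm.trans_le hP.annihilator_le
        · exact (Ideal.span_singleton_le_iff_mem _).mpr haP
      have h3 := h1.trans h2
      rw [hlen, List.length_cons] at h3
      exact absurd (by exact_mod_cast h3) (Nat.not_succ_le_self as.length)
    have : Nontrivial (QuotSMulTop a M) := nontrivial_quotSMulTop_of_mem_maximalIdeal M ha
    refine .cons hreg (ih has' (hrad.trans (Ideal.radical_mono ?_))
      (exists_isRegular_quotSMulTop ha hreg h))
    rw [Ideal.ofList_cons, ← sup_assoc]
    refine sup_le_sup_right (sup_le ?_ ?_) _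
    · exact LinearMap.annihilator_le_of_surjective _ (Submodule.mkQ_surjective _)
    · rw [Ideal.span_singleton_le_iff_mem, Module.mem_annihilator]
      intro z
      obtain ⟨w, rfl⟩ := Submodule.mkQ_surjective _ z
      rw [← map_smul, Submodule.mkQ_apply, Submodule.Quotient.mk_eq_zero]
      exact Submodule.smul_mem_pointwise_smul _ _ _ trivial

theorem Ideal.exists_sum_of_mem_mul_span_finset {R : Type*} [CommRing R] {I : Ideal R}
    {s : Finset R} {x : R} (hx : x ∈ I * Ideal.span (s : Set R)) :
    ∃ f : R → R, (∀ a, f a ∈ I) ∧ ∑ a ∈ s, f a * a = x := by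
  classical
  refine Submodule.mul_induction_on hx (fun b hb c hc => ?_) ?_
  · obtain ⟨f, -, hf⟩ := Submodule.mem_span_finset.mp hc
    refine ⟨fun a => b * f a, fun a => I.mul_mem_right _ hb, ?_⟩
    simp [← hf, Finset.mul_sum, mul_assoc]
  · rintro _ _ ⟨f, hf, rfl⟩ ⟨g, hg, rfl⟩
    exact ⟨f + g, fun a => I.add_mem (hf a) (hg a), by simp [add_mul, Finset.sum_add_distrib]⟩

/-- The relations on a regular sequence have coefficients in the ideal it generates. -/
theorem RingTheory.Sequence.IsWeaklyRegular.mem_ofList_of_sum_eq_zero {R : Type*} [CommRing R]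
    {rs : List R} (reg : IsWeaklyRegular R rs) (hnd : rs.Nodup) {e : R → R}
    (he : (rs.map fun a => e a * a).sum = 0) : ∀ a ∈ rs, e a ∈ Ideal.ofList rs := by
  classical
  induction rs using List.reverseRecOn generalizing e with
  | nil => simp
  | append_singleton rs r ih =>
    rw [isWeaklyRegular_append_iff, isWeaklyRegular_singleton_iff] at reg
    have hnd' : rs.Nodup := hnd.of_append_left
    simp only [List.map_append, List.map_cons, List.map_nil, List.sum_append, List.sum_cons,
      List.sum_nil, add_zero] at he
    have hsum : (rs.map fun a => e a * a).sum ∈ Ideal.ofList rs :=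
      list_sum_mem fun b hb => by
        obtain ⟨a, ha, rfl⟩ := List.mem_map.mp hb
        exact Ideal.mul_mem_left _ _ (Ideal.subset_span ha)
    have her : e r ∈ Ideal.ofList rs := by
      have h1 : r • e r ∈ Ideal.ofList rs := by
        rw [smul_eq_mul, mul_comm, eq_neg_of_add_eq_zero_right he]
        exact neg_mem hsum
      have h2 := reg.2.right_eq_zero_of_smul (x := Submodule.Quotient.mk (e r))
        (by rw [← Submodule.Quotient.mk_smul, Submodule.Quotient.mk_eq_zero]; simpa using h1)
      rw [Submodule.Quotient.mk_eq_zero] at h2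
      simpa using h2
    obtain ⟨f, -, hf⟩ := Ideal.exists_sum_of_mem_mul_span_finset (I := ⊤) (s := rs.toFinset)
      (x := e r) (by simpa [Ideal.ofList] using her)
    rw [List.sum_toFinset _ hnd'] at hf
    have key := ih reg.1 hnd' (e := fun a => e a + r * f a) (by
      rw [← he, ← hf, ← List.sum_map_mul_right, ← List.sum_map_add]
      congr 1
      refine List.map_congr_left fun a _ => ?_
      ring)
    have hle : Ideal.ofList rs ≤ Ideal.ofList (rs ++ [r]) := by simp
    have hr : r ∈ Ideal.ofList (rs ++ [r]) := Ideal.subset_span (by simp)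
    intro a ha
    rcases List.mem_append.mp ha with ha | ha
    · have := sub_mem (hle (key a ha)) (Ideal.mul_mem_right (f a) _ hr)
      simpa using this
    · rw [List.mem_singleton.mp ha]
      exact hle her

/-- If `J` is a parameter ideal of a Cohen–Macaulay local ring, then the generators of `J` are
independent over `R ⧸ J` in `J ⧸ J ^ 2`. -/
theorem IsCMLocal.mem_span_of_sum_mem_span_sq {R : Type*} [CommRing R] [IsNoetherianRing R]
    [IsLocalRing R] (hCM : IsCMLocal R) {s : Finset R}
    (hcard : (s.card : WithBot (WithTop ℕ)) = ringKrullDim R)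
    (hrad : (Ideal.span (s : Set R)).radical = maximalIdeal R) {c : R → R}
    (hc : ∑ a ∈ s, c a * a ∈ Ideal.span (s : Set R) ^ 2) :
    ∀ a ∈ s, c a ∈ Ideal.span (s : Set R) := by
  have hof : Ideal.ofList s.toList = Ideal.span (s : Set R) := by simp [Ideal.ofList]
  obtain ⟨rs, hmem, hreg, hlen⟩ := hCM
  have hlen' : rs.length = s.card := by
    rw [← hcard] at hlen
    exact_mod_cast hlen
  have reg : IsWeaklyRegular R s.toList := by
    refine isWeaklyRegular_of_maximalIdeal_le_radical (fun a ha => ?_) ?_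
      ⟨rs, by simpa using hlen', hmem, hreg⟩
    · rw [← hrad]
      exact Ideal.le_radical (Ideal.subset_span (by simpa using ha))
    · rw [hof, ← hrad]
      exact Ideal.radical_mono le_sup_right
  rw [pow_two] at hc
  obtain ⟨d, hd, hsum⟩ := Ideal.exists_sum_of_mem_mul_span_finset hc
  have key := reg.mem_ofList_of_sum_eq_zero s.nodup_toList (e := fun a => c a - d a) (by
    rw [Finset.sum_map_toList]
    simp [sub_mul, Finset.sum_sub_distrib, hsum])
  intro a ha
  have := add_mem (key a (by simpa using ha)) (hof ▸ hd a)
  rw [hof] at this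
  simpa using this

end CohenMacaulay

/-- Let `(R,m)` be a Noetherian local Cohen–Macaulay non-regular ring of
characteristic `p` such that `m` is a strong test ideal, and let `J` be a parameter ideal
with `length((J:m)/J) = 1` (encoded: `J:m` covers `J`). Then `x ∈ J*` implies
`x² ∈ J·x + J²`. -/
theorem sq_mem_of_tight_closure {R : Type*} [CommRing R] [IsNoetherianRing R]
    [IsLocalRing R] (p : ℕ) [Fact p.Prime] [CharP R p]
    (hCM : IsCMLocal R) (hnotreg : ¬ IsRegLocal R)
    (hstrong : ∀ I : Ideal R,
      (IsLocalRing.maximalIdeal R) * tightClosure p I = (IsLocalRing.maximalIdeal R) * I)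
    (J : Ideal R) (hJ : IsSOPIdeal J)
    (hlen : J < Submodule.colon J (IsLocalRing.maximalIdeal R) ∧
      ∀ K : Ideal R, J ≤ K → K ≤ Submodule.colon J (IsLocalRing.maximalIdeal R) →
        K = J ∨ K = Submodule.colon J (IsLocalRing.maximalIdeal R)) :
    ∀ x : R, InTightClosure p J x → x ^ 2 ∈ J * Ideal.span {x} + J ^ 2 := by
  intro x hx
  obtain ⟨⟨s, hcard, hs⟩, hrad⟩ := hJ
  by_cases hxJ : x ∈ J
  · exact Ideal.mem_sup_left (by
      rw [pow_two]; exact Ideal.mul_mem_mul hxJ (Ideal.mem_span_singleton_self x))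
  have hJm : J ≤ IsLocalRing.maximalIdeal R := Ideal.le_radical.trans_eq hrad
  have hmul : ∀ y ∈ IsLocalRing.maximalIdeal R, y * x ∈ IsLocalRing.maximalIdeal R * J := by
    intro y hy
    rw [← hstrong J]
    exact Ideal.mul_mem_mul hy (Ideal.subset_span hx)
  have hmulJ : ∀ y ∈ IsLocalRing.maximalIdeal R, y * x ∈ J :=
    fun y hy => Ideal.mul_le_right (hmul y hy)
  have hxm : x ∈ IsLocalRing.maximalIdeal R := by
    by_contra hxu
    rw [IsLocalRing.notMem_maximalIdeal] at hxu
    refine hnotreg ⟨s, hcard, hs.trans <| le_antisymm hJm fun y hy => ?_⟩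
    exact (Ideal.mul_unit_mem_iff_mem _ hxu).mp (hmulJ y hy)
  have hcolon : J ⊔ Ideal.span {x} = Submodule.colon J (IsLocalRing.maximalIdeal R) := by
    refine (hlen.2 _ le_sup_left (sup_le hlen.1.le ?_)).resolve_left fun h => hxJ ?_
    · rw [Ideal.span_singleton_le_iff_mem, Submodule.mem_colon]
      intro y hy
      rw [smul_eq_mul, mul_comm]
      exact hmulJ y hy
    · exact h ▸ Ideal.mem_sup_right (Ideal.mem_span_singleton_self x)
  have hsq : x ^ 2 ∈ (⊤ : Ideal R) * Ideal.span (s : Set R) := by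
    rw [Ideal.top_mul, hs, pow_two]
    exact hmulJ x hxm
  obtain ⟨b, -, hb⟩ := Ideal.exists_sum_of_mem_mul_span_finset hsq
  have hbmem : ∀ a ∈ s, b a ∈ J ⊔ Ideal.span {x} := by
    intro a ha
    rw [hcolon, Submodule.mem_colon]
    intro y hy
    rw [smul_eq_mul, mul_comm, ← hs]
    refine hCM.mem_span_of_sum_mem_span_sq hcard (hs ▸ hrad) (c := fun a => y * b a) ?_ a ha
    have h1 : ∑ a ∈ s, y * b a * a = y * x ^ 2 := by
      rw [← hb, Finset.mul_sum]
      exact Finset.sum_congr rfl fun _ _ => mul_assoc _ _ _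
    obtain ⟨f, hf, hfsum⟩ := Ideal.exists_sum_of_mem_mul_span_finset (hs ▸ hmul y hy)
    rw [h1, hs, pow_two x, ← mul_assoc, ← hfsum, Finset.sum_mul, pow_two]
    refine Ideal.sum_mem _ fun c hc => ?_
    rw [mul_right_comm (f c)]
    exact Ideal.mul_mem_mul (hmulJ _ (hf c)) (hs ▸ Ideal.subset_span hc)
  have hfinal : x ^ 2 ∈ J * (J ⊔ Ideal.span {x}) := by
    rw [← hb]
    refine Ideal.sum_mem _ fun a ha => ?_
    rw [mul_comm (b a)]
    exact Ideal.mul_mem_mul (hs ▸ Ideal.subset_span ha) (hbmem a ha)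
  rwa [Ideal.mul_sup, sup_comm, ← pow_two] at hfinal
end

section
/- Let (R,m) be a Cohen–Macaulay Noetherian local ring that is not regular, and let J be an ideal of R generated by a system of parameters. Set I = J :_R m. Then I² = J·I. -/
open IsLocalRing RingTheory.Sequence

/-- Coset prime avoidance: if no prime in the finite set `S` contains both `x` and `K`, then some
element of the coset `x + K` lies outside every prime in `S`. -/
theorem Ideal.exists_add_notMem_of_forall_prime {R : Type*} [CommRing R] (S : Finset (Ideal R))
    (hS : ∀ p ∈ S, p.IsPrime) (x : R) (K : Ideal R) (hxK : ∀ p ∈ S, x ∈ p → ¬ K ≤ p) :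
    ∃ k ∈ K, ∀ p ∈ S, x + k ∉ p := by
  classical
  induction S using Finset.strongInduction with
  | H S ih =>
  rcases S.eq_empty_or_nonempty with rfl | hne
  · exact ⟨0, K.zero_mem, by simp⟩
  obtain ⟨p, hp⟩ := S.exists_minimal hne
  obtain ⟨k, hk, hav⟩ := ih (S.erase p) (Finset.erase_ssubset hp.prop)
    (fun q hq => hS q (Finset.mem_of_mem_erase hq))
    (fun q hq => hxK q (Finset.mem_of_mem_erase hq))
  by_cases hxk : x + k ∈ p
  · have hKp : ¬ K ≤ p := fun h => hxK p hp.prop ((p.add_mem_iff_left (h hk)).mp hxk) h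
    have hinf : ¬ K ⊓ (S.erase p).inf id ≤ p := by
      rw [Ideal.IsPrime.inf_le (hS p hp.prop), Ideal.IsPrime.inf_le' (hS p hp.prop)]
      rintro (h | ⟨q, hq, hqp⟩)
      · exact hKp h
      · exact Finset.ne_of_mem_erase hq
          (le_antisymm hqp (hp.le_of_le (Finset.mem_of_mem_erase hq) hqp))
    obtain ⟨l, hl, hlp⟩ := SetLike.not_le_iff_exists.mp hinf
    obtain ⟨hlK, hlinf⟩ := Submodule.mem_inf.mp hl
    refine ⟨k + l, K.add_mem hk hlK, fun q hq hmem => ?_⟩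
    rw [← add_assoc] at hmem
    by_cases hqp : q = p
    · subst hqp
      exact hlp ((q.add_mem_iff_right hxk).mp hmem)
    · have hq' := Finset.mem_erase.mpr ⟨hqp, hq⟩
      have hlq : l ∈ q := Finset.inf_le (f := id) hq' hlinf
      exact hav q hq' ((q.add_mem_iff_left hlq).mp hmem)
  · refine ⟨k, hk, fun q hq => ?_⟩
    by_cases hqp : q = p
    · exact hqp ▸ hxk
    · exact hav q (Finset.mem_erase.mpr ⟨hqp, hq⟩)

theorem RingTheory.Sequence.isWeaklyRegular_concat_iff {R : Type*} [CommRing R] (rs : List R)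
    (r : R) : IsWeaklyRegular R (rs ++ [r]) ↔
      IsWeaklyRegular R rs ∧ ∀ c, r * c ∈ Ideal.ofList rs → c ∈ Ideal.ofList rs := by
  rw [isWeaklyRegular_append_iff, isWeaklyRegular_singleton_iff,
    isSMulRegular_quotient_iff_mem_of_smul_mem]
  simp

section Local

variable {R : Type*} [CommRing R] [IsNoetherianRing R] [IsLocalRing R]

/-- If the ideal generated by `x` and `K` is primary to the maximal ideal and some element of the
maximal ideal is regular modulo `L`, then so is some element of the coset `x + K`. -/
theorem IsLocalRing.exists_add_isSMulRegular {K L : Ideal R} {x r : R}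
    (hr : r ∈ maximalIdeal R) (hreg : IsSMulRegular (R ⧸ L) r)
    (hK : (Ideal.span {x} ⊔ K).radical = maximalIdeal R) :
    ∃ k ∈ K, IsSMulRegular (R ⧸ L) (x + k) := by
  have key (s : R) : (∀ p ∈ associatedPrimes R (R ⧸ L), s ∉ p) ↔ IsSMulRegular (R ⧸ L) s := by
    have := congrArg (s ∈ ·) (biUnion_associatedPrimes_eq_compl_regular (R := R) (R ⧸ L))
    simp only [Set.mem_iUnion, Set.mem_compl_iff, Set.mem_ofPred_eq, eq_iff_iff,
      SetLike.mem_coe] at this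
    simpa using not_congr this
  have hfin := associatedPrimes.finite R (R ⧸ L)
  obtain ⟨k, hk, h⟩ := Ideal.exists_add_notMem_of_forall_prime hfin.toFinset
    (fun p hp => ((hfin.mem_toFinset).mp hp).isPrime) x K (by
      intro p hp hx hKp
      rw [hfin.mem_toFinset] at hp
      have hle : maximalIdeal R ≤ p := by
        rw [← hK, hp.isPrime.radical_le_iff]
        exact sup_le (by simpa [Ideal.span_singleton_le_iff_mem]) hKp
      exact (key r).mpr hreg p hp (hle hr))
  exact ⟨k, hk, (key _).mp fun p hp => h p (hfin.mem_toFinset.mpr hp)⟩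

/-- Elements generating an ideal primary to the maximal ideal can be exchanged for the same number
of elements of a regular sequence. -/
theorem IsLocalRing.isWeaklyRegular_append_of_radical_eq (xs rs ys : List R)
    (hlen : rs.length = xs.length) (hmem : ∀ r ∈ rs, r ∈ maximalIdeal R)
    (hreg : IsWeaklyRegular R (rs ++ ys))
    (hrad : (Ideal.ofList (xs ++ ys)).radical = maximalIdeal R) :
    IsWeaklyRegular R (xs ++ ys) := by
  induction xs generalizing rs ys with
  | nil =>
    obtain rfl := List.length_eq_zero_iff.mp hlen
    exact hreg
  | cons x xs ih =>
    obtain _ | ⟨r, rs⟩ := rs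
    · simp at hlen
    have hle : ∀ z ∈ x :: xs ++ ys, z ∈ maximalIdeal R := fun z hz =>
      hrad ▸ Ideal.le_radical (Ideal.subset_span hz)
    have hys : ∀ z ∈ ys, z ∈ maximalIdeal R := fun z hz => hle z (by simp [hz])
    have hr := hmem r (by simp)
    have hrs : ∀ z ∈ rs, z ∈ maximalIdeal R := fun z hz => hmem z (by simp [hz])
    have h1 : IsWeaklyRegular R (rs ++ ys ++ [r]) :=
      isWeaklyRegular_of_perm_of_subset_maximalIdeal hreg (List.perm_append_singleton r _).symm
        (by simp only [List.mem_append]; rintro z (hz | hz) <;> [exact hmem z hz; exact hys z hz])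
    rw [isWeaklyRegular_concat_iff] at h1
    have h2 : IsSMulRegular (R ⧸ Ideal.ofList (rs ++ ys)) r :=
      (isSMulRegular_quotient_iff_mem_of_smul_mem _ _).mpr h1.2
    obtain ⟨k, hk, hy⟩ := exists_add_isSMulRegular (x := x) (K := Ideal.ofList (xs ++ ys)) hr h2
      (by rw [← Ideal.ofList_cons]; exact hrad)
    have hym : x + k ∈ maximalIdeal R :=
      add_mem (hle x (by simp)) (Ideal.span_le.mpr (fun z hz => hle z (by simp_all)) hk)
    have h3 : IsWeaklyRegular R (rs ++ (x + k) :: ys) := by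
      refine isWeaklyRegular_of_perm_of_subset_maximalIdeal
        ((isWeaklyRegular_concat_iff (rs ++ ys) (x + k)).mpr
          ⟨h1.1, (isSMulRegular_quotient_iff_mem_of_smul_mem _ _).mp hy⟩)
        ((List.perm_append_singleton _ _).trans List.perm_middle.symm) ?_
      simp only [List.mem_append, List.mem_singleton]
      rintro z ((hz | hz) | rfl) <;> [exact hrs z hz; exact hys z hz; exact hym]
    have hxs : ∀ z ∈ xs ++ ys, z ∈ maximalIdeal R := fun z hz => hle z (by simp_all)
    have hideal : Ideal.ofList (xs ++ (x + k) :: ys) = Ideal.ofList (x :: xs ++ ys) := by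
      have : Ideal.ofList (xs ++ (x + k) :: ys) = Ideal.span {x + k} ⊔ Ideal.ofList (xs ++ ys) := by
        simp only [Ideal.ofList_append, Ideal.ofList_cons]
        ac_rfl
      rw [this, List.cons_append, Ideal.ofList_cons]
      apply le_antisymm <;> refine sup_le ?_ le_sup_right <;>
        rw [Ideal.span_singleton_le_iff_mem]
      · exact add_mem (Ideal.mem_sup_left (Ideal.mem_span_singleton_self x))
          (Ideal.mem_sup_right hk)
      · simpa using sub_mem (Ideal.mem_sup_left (Ideal.mem_span_singleton_self (x + k)))
          (Ideal.mem_sup_right hk : k ∈ Ideal.span {x + k} ⊔ Ideal.ofList (xs ++ ys))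
    have h4 := ih rs ((x + k) :: ys) (by simpa using hlen) hrs h3 (hideal ▸ hrad)
    have h5 : IsWeaklyRegular R (xs ++ ys ++ [x + k]) := by
      refine isWeaklyRegular_of_perm_of_subset_maximalIdeal h4
        (List.perm_middle.trans (List.perm_append_singleton _ _).symm) ?_
      simp only [List.mem_append, List.mem_cons]
      rintro z (hz | rfl | hz) <;>
        [exact hxs z (by simp [hz]); exact hym; exact hys z hz]
    rw [isWeaklyRegular_concat_iff] at h5
    have h6 : IsWeaklyRegular R (xs ++ ys ++ [x]) := by
      refine (isWeaklyRegular_concat_iff _ _).mpr ⟨h5.1, fun c hc => h5.2 c ?_⟩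
      rw [add_mul]
      exact add_mem hc (Ideal.mul_mem_right _ _ hk)
    refine isWeaklyRegular_of_perm_of_subset_maximalIdeal h6 (List.perm_append_singleton x _) ?_
    intro z hz
    exact hle z (by simpa [or_comm, or_assoc, or_left_comm] using hz)

/-- In a Cohen–Macaulay local ring, each member of a system of parameters is a nonzerodivisor
modulo the remaining ones. -/
theorem IsCMLocal.mem_ofList_of_mul_mem (hCM : IsCMLocal R) {x c : R} {xs : List R}
    (hlen : ((xs.length + 1 : ℕ) : WithBot (WithTop ℕ)) = ringKrullDim R)
    (hrad : (Ideal.ofList (x :: xs)).radical = maximalIdeal R)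
    (hc : x * c ∈ Ideal.ofList xs) : c ∈ Ideal.ofList xs := by
  obtain ⟨rs, hmem, hreg, hdim⟩ := hCM
  have hlen' : rs.length = (xs ++ [x]).length := by
    rw [← hlen] at hdim
    have := WithBot.coe_injective hdim
    have := WithTop.coe_injective this
    simpa using this
  have hrad' : (Ideal.ofList (xs ++ [x] ++ [])).radical = maximalIdeal R := by
    rw [← hrad, List.append_nil, Ideal.ofList_append, Ideal.ofList_singleton,
      Ideal.ofList_cons, sup_comm]
  have := isWeaklyRegular_append_of_radical_eq (xs ++ [x]) rs [] hlen' hmem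
    (by simpa using hreg.toIsWeaklyRegular) hrad'
  rw [List.append_nil, isWeaklyRegular_concat_iff] at this
  exact this.2 c hc

/-- A version of `IsCMLocal.mem_ofList_of_mul_mem` for ideals of the form `span {x} ⊔ span t`. -/
theorem IsCMLocal.mem_span_of_mul_mem (hCM : IsCMLocal R) {x c : R} {t : Finset R}
    (hcard : ((t.card + 1 : ℕ) : WithBot (WithTop ℕ)) = ringKrullDim R)
    (hrad : (Ideal.span {x} ⊔ Ideal.span (t : Set R)).radical = maximalIdeal R)
    (hc : x * c ∈ Ideal.span (t : Set R)) : c ∈ Ideal.span (t : Set R) := by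
  have ht : Ideal.ofList t.toList = Ideal.span (t : Set R) := by
    simp [Ideal.ofList]
  rw [← ht] at hc ⊢
  exact hCM.mem_ofList_of_mul_mem (by simpa using hcard) (by rwa [Ideal.ofList_cons, ht]) hc

theorem isRegLocal_of_card_le {s : Finset R} (hs : Ideal.span (s : Set R) = maximalIdeal R)
    (hcard : (s.card : WithBot (WithTop ℕ)) ≤ ringKrullDim R) : IsRegLocal R := by
  refine ⟨s, le_antisymm hcard ((ringKrullDim_le_spanFinrank_maximalIdeal R).trans ?_), hs⟩
  have : (maximalIdeal R).spanFinrank ≤ s.card := by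
    rw [← hs, ← Set.ncard_coe_finset]
    exact Submodule.spanFinrank_span_le_ncard_of_finite s.finite_toSet
  exact Nat.cast_le.mpr this

/-- In a Cohen–Macaulay local ring that is not regular, if `a` multiplies the maximal ideal into a
parameter ideal, then writing any such product in terms of the parameters only uses coefficients
from the maximal ideal. -/
theorem IsCMLocal.coeff_mem_maximalIdeal (hCM : IsCMLocal R) (hnotreg : ¬ IsRegLocal R)
    {s : Finset R} (hcard : (s.card : WithBot (WithTop ℕ)) = ringKrullDim R)
    (hrad : (Ideal.span (s : Set R)).radical = maximalIdeal R) {a y : R}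
    (ha : ∀ z ∈ maximalIdeal R, a * z ∈ Ideal.span (s : Set R)) (hy : y ∈ maximalIdeal R)
    {f : R → R} (hf : ∑ i ∈ s, f i * i = a * y) {x : R} (hx : x ∈ s) :
    f x ∈ maximalIdeal R := by
  classical
  by_contra hfx
  have hunit : IsUnit (f x) := by simpa using hfx
  set K := Ideal.span ((s.erase x : Finset R) : Set R) with hK
  have hs : Ideal.span (s : Set R) = Ideal.span {x} ⊔ K := by
    rw [hK, ← Ideal.span_insert, ← Finset.coe_insert, Finset.insert_erase hx]
  have hrest : ∑ i ∈ s.erase x, f i * i ∈ K :=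
    sum_mem fun i hi => Ideal.mul_mem_left _ _ (Ideal.subset_span hi)
  have hsum : f x * x + ∑ i ∈ s.erase x, f i * i = a * y := by
    rw [← hf, Finset.add_sum_erase s (fun i => f i * i) hx]
  have hs' : Ideal.span {a * y} ⊔ K = Ideal.span (s : Set R) := by
    apply le_antisymm
    · refine sup_le ?_ (hs ▸ le_sup_right)
      exact (Ideal.span_singleton_le_iff_mem _).mpr (ha y hy)
    · rw [hs]
      refine sup_le ?_ le_sup_right
      rw [Ideal.span_singleton_le_iff_mem, ← Ideal.unit_mul_mem_iff_mem _ hunit,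
        eq_sub_of_add_eq hsum]
      exact sub_mem (Ideal.mem_sup_left (Ideal.mem_span_singleton_self _))
        (Ideal.mem_sup_right hrest)
  have hcard' : (s.erase x).card + 1 = s.card := Finset.card_erase_add_one hx
  have hle : maximalIdeal R ≤ Ideal.span {y} ⊔ K := by
    intro z hz
    have haz := ha z hz
    rw [← hs'] at haz
    obtain ⟨t, k, hk, htk⟩ := Ideal.mem_span_singleton_sup.mp haz
    have : z - t * y ∈ K := by
      refine hCM.mem_span_of_mul_mem (x := a * y) (by rw [hcard', hcard])
        (by rw [← hK, hs', hrad]) ?_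
      have : a * y * (z - t * y) = y * k := by linear_combination -y * htk
      rw [this]
      exact Ideal.mul_mem_left _ _ hk
    rw [← sub_add_cancel z (t * y)]
    exact add_mem (Ideal.mem_sup_right this)
      (Ideal.mem_sup_left (Ideal.mul_mem_left _ _ (Ideal.mem_span_singleton_self y)))
  refine hnotreg (isRegLocal_of_card_le (s := insert y (s.erase x)) ?_ ?_)
  · rw [Finset.coe_insert, Ideal.span_insert]
    refine le_antisymm (sup_le ((Ideal.span_singleton_le_iff_mem _).mpr hy) ?_) hle
    exact (hs ▸ le_sup_right : K ≤ Ideal.span (s : Set R)).trans (hrad ▸ Ideal.le_radical)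
  · rw [← hcard]
    have := Finset.card_insert_le y (s.erase x)
    rw [hcard'] at this
    exact_mod_cast this

end Local

/-- **Corso–Polini.** If `(R,m)` is Cohen–Macaulay, Noetherian local and not
regular, and `J` is a parameter ideal, then `I² = J·I` where `I = J :_R m`. -/
theorem corso_polini {R : Type*} [CommRing R] [IsNoetherianRing R] [IsLocalRing R]
    (hCM : IsCMLocal R) (hnotreg : ¬ IsRegLocal R)
    (J : Ideal R) (hJ : IsSOPIdeal J) :
    (Submodule.colon J (IsLocalRing.maximalIdeal R)) ^ 2 =
      J * Submodule.colon J (IsLocalRing.maximalIdeal R) := by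
  classical
  obtain ⟨⟨s, hcard, rfl⟩, hrad⟩ := hJ
  set J := Ideal.span (s : Set R) with hJ
  set I := Submodule.colon J (maximalIdeal R) with hI
  have hJm : J ≤ maximalIdeal R := hrad ▸ Ideal.le_radical
  have hmul {a : R} (ha : a ∈ I) : ∀ z ∈ maximalIdeal R, a * z ∈ J :=
    fun z hz => Submodule.mem_colon.mp ha z hz
  have hIm : I ≤ maximalIdeal R := by
    refine le_maximalIdeal fun h => hnotreg ⟨s, hcard, le_antisymm hJm fun z hz => ?_⟩
    simpa using hmul (h ▸ Submodule.mem_top : (1 : R) ∈ I) z hz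
  have hJI : J ≤ I := Ideal.le_colon
  rw [pow_two]
  refine le_antisymm (Ideal.mul_le.mpr fun a ha b hb => ?_) (Ideal.mul_mono_left hJI)
  have hab := hmul ha b (hIm hb)
  obtain ⟨c, -, hc⟩ := Submodule.mem_span_finset.mp hab
  simp only [smul_eq_mul] at hc
  rw [← hc]
  refine sum_mem fun x hx => ?_
  rw [mul_comm (c x)]
  refine Ideal.mul_mem_mul (Ideal.subset_span hx) (Submodule.mem_colon.mpr fun y hy => ?_)
  obtain ⟨f, -, hf⟩ := Submodule.mem_span_finset.mp (hmul ha y hy)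
  simp only [smul_eq_mul] at hf
  have hfx := hCM.coeff_mem_maximalIdeal hnotreg hcard hrad (hmul ha) hy hf hx
  have hKJ : Ideal.span ((s.erase x : Finset R) : Set R) ≤ J :=
    Ideal.span_mono (by simp)
  have hs : Ideal.span {x} ⊔ Ideal.span ((s.erase x : Finset R) : Set R) = J := by
    rw [← Ideal.span_insert, ← Finset.coe_insert, Finset.insert_erase hx]
  have hdiff : c x * y - f x * b ∈ J := by
    refine hKJ (hCM.mem_span_of_mul_mem (x := x) (by rw [Finset.card_erase_add_one hx, hcard])
      (by rw [hs, hrad]) ?_)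
    have hzero : ∑ i ∈ s, (c i * y - f i * b) * i = 0 := by
      calc ∑ i ∈ s, (c i * y - f i * b) * i
          = (∑ i ∈ s, c i * i) * y - (∑ i ∈ s, f i * i) * b := by
            rw [Finset.sum_mul, Finset.sum_mul, ← Finset.sum_sub_distrib]
            exact Finset.sum_congr rfl fun i _ => by ring
        _ = 0 := by rw [hc, hf]; ring
    rw [← Finset.add_sum_erase s _ hx, mul_comm] at hzero
    rw [eq_neg_of_add_eq_zero_left hzero]
    exact neg_mem (sum_mem fun i hi => Ideal.mul_mem_left _ _ (Ideal.subset_span hi))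
  have := add_mem hdiff (mul_comm (f x) b ▸ hmul hb (f x) hfx : f x * b ∈ J)
  simpa using this
end

section
/- Let (R,m) be an F-finite Noetherian local domain of prime characteristic p, let e ≥ 1 and q = p^e, and let φ : R → R be a nonzero additive map satisfying φ(r^q·x) = r·φ(x) for all r, x ∈ R. Then there exists c ≠ 0 in R such that for every d ≠ 0 in R there exist a positive integer n and s ∈ R with c = φ^{∘n}(d·s), where φ^{∘n} denotes the n-fold composite of φ (equivalently, c ∈ φ^n((dR)^{1/p^{ne}})). -/
open Matrix in
/-- Duality for a finite ring map `f : R → S` out of a domain and a nondegenerate `R`-linear form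
`φ` on `S`: up to a fixed nonzero multiple, every `x : S` is a combination of fixed elements of
`S` with coefficients of the form `φ (x * s)`. -/
lemma exists_mul_eq_sum_of_nondegenerate {R S : Type*} [CommRing R] [IsDomain R] [CommRing S]
    (f : R →+* S) (hf : f.Finite) (φ : S →+ R) (hφ : ∀ r x, φ (f r * x) = r * φ x)
    (hnd : ∀ a, (∀ x, φ (a * x) = 0) → a = 0) :
    ∃ g : R, g ≠ 0 ∧ ∃ (ι : Type) (_ : Fintype ι) (b : ι → S), ∀ x, ∃ μ : ι → R,
      (∀ i, ∃ s, μ i = φ (x * s)) ∧ f g * x = ∑ i, f (μ i) * b i := by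
  classical
  let _ : Algebra R S := f.toAlgebra
  have hsmul (r : R) (x : S) : r • x = f r * x := rfl
  have : Module.Finite R S := hf
  obtain ⟨N, v, hv⟩ := Submodule.fg_iff_exists_fin_generating_family.mp
    (Module.Finite.fg_top (R := R) (M := S))
  obtain ⟨I, hI, hmax⟩ := exists_maximal_linearIndepOn R v
  choose! a ha0 ha using hmax
  let b : I → S := fun i => v i
  have hb : LinearIndependent R b := hI
  have hspan : Submodule.span R (v '' I) = Submodule.span R (Set.range b) := by
    rw [Set.image_eq_range]
  obtain ⟨g, hg0, hg⟩ : ∃ g : R, g ≠ 0 ∧ ∀ x : S, g • x ∈ Submodule.span R (Set.range b) := by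
    refine ⟨∏ i with i ∉ I, a i, Finset.prod_ne_zero_iff.mpr fun i hi =>
      ha0 i (Finset.mem_filter.mp hi).2, fun x => ?_⟩
    have hx : x ∈ Submodule.span R (Set.range v) := hv ▸ Submodule.mem_top
    induction hx using Submodule.span_induction with
    | mem y hy =>
      obtain ⟨i, rfl⟩ := hy
      by_cases hi : i ∈ I
      · exact Submodule.smul_mem _ _ (Submodule.subset_span ⟨⟨i, hi⟩, rfl⟩)
      · rw [← Finset.prod_erase_mul _ _ (Finset.mem_filter.mpr ⟨Finset.mem_univ i, hi⟩), mul_smul]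
        exact Submodule.smul_mem _ _ (hspan ▸ ha i hi)
    | zero => simp
    | add y z _ _ hy hz => rw [smul_add]; exact add_mem hy hz
    | smul r y _ hy => rw [smul_comm]; exact Submodule.smul_mem _ _ hy
  have hcoord (x : S) : ∃ c : I → R, f g * x = ∑ i, f (c i) * b i := by
    obtain ⟨c, hc⟩ := (Submodule.mem_span_range_iff_exists_fun R).mp (hg x)
    exact ⟨c, hc.symm⟩
  let G : Matrix I I R := Matrix.of fun i j => φ (b i * b j)
  have hG (c : I → R) (i : I) : (G *ᵥ c) i = φ (b i * ∑ j, f (c j) * b j) := by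
    simp only [mulVec, dotProduct, G, Matrix.of_apply, Finset.mul_sum, map_sum]
    refine Finset.sum_congr rfl fun j _ => ?_
    rw [mul_left_comm, hφ, mul_comm]
  have hdet : G.det ≠ 0 := by
    intro h
    obtain ⟨c, hc0, hc⟩ := Matrix.exists_mulVec_eq_zero_iff.mpr h
    refine hc0 (funext (Fintype.linearIndependent_iff.mp hb c (hnd _ fun x => ?_)))
    obtain ⟨l, hl⟩ := hcoord x
    refine (mul_eq_zero.mp ?_).resolve_left hg0
    rw [← hφ, mul_left_comm, hl, Finset.mul_sum, map_sum]
    refine Finset.sum_eq_zero fun i _ => ?_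
    rw [mul_left_comm, hφ, mul_comm _ (b i)]
    have := hG c i
    simp only [hc, Pi.zero_apply, hsmul] at this ⊢
    rw [← this, mul_zero]
  refine ⟨G.det * g, mul_ne_zero hdet hg0, I, inferInstance, b, fun x => ?_⟩
  obtain ⟨l, hl⟩ := hcoord x
  refine ⟨G.det • l, fun i => ⟨∑ j, f (G.adjugate i j * g) * b j, ?_⟩, ?_⟩
  · have h : G.adjugate *ᵥ (G *ᵥ l) = G.det • l := by
      rw [mulVec_mulVec, adjugate_mul, smul_mulVec, one_mulVec]
    rw [← h]
    change ∑ j, G.adjugate i j * (G *ᵥ l) j = _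
    rw [Finset.mul_sum, map_sum]
    refine Finset.sum_congr rfl fun j _ => ?_
    rw [hG, ← hl, mul_left_comm x, hφ, mul_assoc, ← hφ g, mul_left_comm (b j), mul_comm (b j)]
  · rw [map_mul, mul_assoc, hl, Finset.mul_sum]
    exact Finset.sum_congr rfl fun i _ => by simp [mul_assoc]

section PowSemilinear

variable {R : Type*} [CommRing R] {q : ℕ} {φ : R →+ R}

lemma iterate_pow_mul (hφ : ∀ r x : R, φ (r ^ q * x) = r * φ x) (n : ℕ) (r x : R) :
    (⇑φ)^[n] (r ^ q ^ n * x) = r * (⇑φ)^[n] x := by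
  induction n generalizing x with
  | zero => simp
  | succ n ih => rw [Function.iterate_succ_apply, pow_succ, pow_mul, hφ, ih,
      Function.iterate_succ_apply]

/-- The ideal `φⁿ(dR)` for a map `φ` with `φ (r ^ q * x) = r * φ x`. -/
def iterateImage (hφ : ∀ r x : R, φ (r ^ q * x) = r * φ x) (d : R) (n : ℕ) : Ideal R where
  carrier := Set.range fun s => (⇑φ)^[n] (d * s)
  add_mem' := by
    rintro _ _ ⟨s, rfl⟩ ⟨t, rfl⟩
    exact ⟨s + t, by simp only [mul_add, iterate_map_add]⟩
  zero_mem' := ⟨0, by simp only [mul_zero, iterate_map_zero]⟩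
  smul_mem' := by
    rintro r _ ⟨s, rfl⟩
    refine ⟨r ^ q ^ n * s, ?_⟩
    simp only [mul_left_comm d, iterate_pow_mul hφ, smul_eq_mul]

lemma mem_iterateImage (hφ : ∀ r x : R, φ (r ^ q * x) = r * φ x) {d x : R} {n : ℕ} :
    x ∈ iterateImage hφ d n ↔ ∃ s, (⇑φ)^[n] (d * s) = x :=
  Iff.rfl

lemma apply_mul_mem_iterateImage (hφ : ∀ r x : R, φ (r ^ q * x) = r * φ x) {d x : R} {n : ℕ}
    (hx : x ∈ iterateImage hφ d n) (y : R) : φ (x * y) ∈ iterateImage hφ d (n + 1) := by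
  obtain ⟨s, rfl⟩ := hx
  refine ⟨y ^ q ^ n * s, ?_⟩
  simp only [mul_left_comm d, Function.iterate_succ_apply', iterate_pow_mul hφ, mul_comm _ y]

lemma exists_iterate_pow_mul_eq_pow_three (hq : 2 ≤ q)
    (hφ : ∀ r x : R, φ (r ^ q * x) = r * φ x) {c t : R} (hc : φ t = c) (m : ℕ) :
    ∃ k s, (⇑φ)^[k] (c ^ m * s) = c ^ 3 := by
  induction m using Nat.strong_induction_on with
  | _ m ih =>
    obtain hm | hm := le_or_gt m 3
    · exact ⟨0, c ^ (3 - m), by rw [Function.iterate_zero_apply, pow_mul_pow_sub c hm]⟩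
    · obtain ⟨k, s, hs⟩ := ih ((m + 1) / 2 + 1) (by omega)
      have hle : m ≤ (m + 1) / 2 * q :=
        le_trans (by omega) (Nat.mul_le_mul_left ((m + 1) / 2) hq)
      refine ⟨k + 1, c ^ ((m + 1) / 2 * q - m) * (s ^ q * t), ?_⟩
      rw [Function.iterate_succ_apply, ← mul_assoc, pow_mul_pow_sub c hle, pow_mul, hφ, hφ, hc,
        mul_left_comm, mul_comm, ← pow_succ, hs]

/-- If `g * x` lies in the square of the ideal `φ(xR)` for all `x`, then for every `d ≠ 0` a power
of `g` lies in some `φⁿ(dR)`. -/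
lemma exists_pow_mem_iterateImage [IsDomain R] [IsNoetherianRing R]
    (hφ : ∀ r x : R, φ (r ^ q * x) = r * φ x) {g : R} (hg0 : g ≠ 0)
    (hg : ∀ x, g * x ∈ Ideal.span (Set.range fun s => φ (x * s)) ^ 2) {d : R} (hd : d ≠ 0) :
    ∃ n m, 1 ≤ n ∧ g ^ m ∈ iterateImage hφ d n := by
  let L := Localization.Away g
  have hpow : Submonoid.powers g ≤ nonZeroDivisors R :=
    powers_le_nonZeroDivisors_of_noZeroDivisors hg0
  have : IsDomain L := IsLocalization.isDomain_localization hpow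
  have : IsNoetherianRing L := IsLocalization.isNoetherianRing (Submonoid.powers g) L inferInstance
  let J : ℕ → Ideal L := fun n => (iterateImage hφ d n).map (algebraMap R L)
  have hJ (n : ℕ) : J n ≤ J (n + 1) ^ 2 := by
    refine Ideal.map_le_iff_le_comap.mpr fun x hx => ?_
    have hmem : g * x ∈ iterateImage hφ d (n + 1) ^ 2 :=
      Ideal.pow_right_mono (Ideal.span_le.mpr (by
        rintro _ ⟨s, rfl⟩
        exact apply_mul_mem_iterateImage hφ hx s)) 2 (hg x)
    have h := Ideal.mem_map_of_mem (algebraMap R L) hmem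
    rw [Ideal.map_pow, map_mul] at h
    exact (Ideal.unit_mul_mem_iff_mem _ (IsLocalization.Away.algebraMap_isUnit (S := L) g)).mp h
  have hmono : Monotone J :=
    monotone_nat_of_le_succ fun n => (hJ n).trans (Ideal.pow_le_self two_ne_zero)
  obtain ⟨n, hn⟩ := monotone_stabilizes_iff_noetherian.mpr ‹IsNoetherianRing L› ⟨J, hmono⟩
  replace hn (m : ℕ) (h : n ≤ m) : J n = J m := hn m h
  have hidem : IsIdempotentElem (J n) := by
    refine le_antisymm Ideal.mul_le_left ?_
    rw [← pow_two]
    exact (hJ n).trans_eq (by rw [← hn (n + 1) n.le_succ])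
  have htop : J (n + 1) = ⊤ := by
    rw [← hn (n + 1) n.le_succ]
    refine ((Ideal.isIdempotentElem_iff_eq_bot_or_top _
      (IsNoetherian.noetherian _)).mp hidem).resolve_left fun hbot => hd ?_
    have h : algebraMap R L d ∈ J n :=
      hmono n.zero_le (Ideal.mem_map_of_mem _ ⟨1, by simp⟩)
    rw [hbot, Ideal.mem_bot] at h
    exact (IsLocalization.injective L hpow) (h.trans (map_zero _).symm)
  have hmeet : ¬ Disjoint (Submonoid.powers g : Set R) (iterateImage hφ d (n + 1)) := by
    rwa [← IsLocalization.map_algebraMap_ne_top_iff_disjoint (Submonoid.powers g) L, not_not]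
  obtain ⟨_, ⟨m, rfl⟩, hm⟩ := Set.not_disjoint_iff.mp hmeet
  exact ⟨n + 1, m, by omega, hm⟩

end PowSemilinear

lemma iterateFrobenius_finite {R : Type*} [CommRing R] (p : ℕ) [Fact p.Prime] [CharP R p]
    (hFF : (frobenius R p).Finite) (e : ℕ) : (iterateFrobenius R p e).Finite := by
  induction e with
  | zero => simpa using RingHom.Finite.id R
  | succ e ih =>
    rw [iterateFrobenius_add, iterateFrobenius_one]
    exact ih.comp hFF


/-- **Hochster–Huneke test elements.** For an F-finite Noetherian local domain
`R` of characteristic `p` and a nonzero `p^{-e}`-linear map `φ`, there is `c ≠ 0` such that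
for every `d ≠ 0` one has `c ∈ φⁿ((dR)^{1/pⁿᵉ})` for some `n ≥ 1`. -/
theorem hochster_huneke_test_element {R : Type*} [CommRing R] [IsDomain R]
    [IsNoetherianRing R] [IsLocalRing R] (p : ℕ) [Fact p.Prime] [CharP R p]
    (hFF : (frobenius R p).Finite)
    (e q : ℕ) (he : 1 ≤ e) (hq : q = p ^ e)
    (φ : R →+ R) (hφ : ∀ r x : R, φ (r ^ q * x) = r * φ x) (hφ0 : φ ≠ 0) :
    ∃ c : R, c ≠ 0 ∧ ∀ d : R, d ≠ 0 →
      ∃ n : ℕ, 1 ≤ n ∧ ∃ s : R, c = (⇑φ)^[n] (d * s) := by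
  have hp := (Fact.out : p.Prime)
  have hq2 : 2 ≤ q := hq ▸ hp.two_le.trans (Nat.le_self_pow (by omega) p)
  obtain ⟨t, ht⟩ := DFunLike.ne_iff.mp hφ0
  rw [AddMonoidHom.zero_apply] at ht
  have hnd (a : R) (ha : ∀ x, φ (a * x) = 0) : a = 0 := by
    refine (mul_eq_zero.mp ?_).resolve_right ht
    rw [← hφ, ← ha (a ^ (q - 1) * t), ← mul_assoc, mul_pow_sub_one (by omega)]
  obtain ⟨g, hg0, ι, _, b, hb⟩ := exists_mul_eq_sum_of_nondegenerate (iterateFrobenius R p e)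
    (iterateFrobenius_finite p hFF e) φ (by simpa [iterateFrobenius_def, ← hq] using hφ) hnd
  simp only [iterateFrobenius_def, ← hq] at hb
  have hgq (x : R) : g ^ q * x ∈ Ideal.span (Set.range fun s => φ (x * s)) ^ 2 := by
    obtain ⟨μ, hμ, hx⟩ := hb x
    rw [hx]
    refine Ideal.sum_mem _ fun i _ => Ideal.mul_mem_right _ _ (Ideal.pow_le_pow_right hq2 ?_)
    obtain ⟨s, hs⟩ := hμ i
    exact Ideal.pow_mem_pow (hs ▸ Ideal.subset_span (Set.mem_range_self s)) q
  have hc0 : g ^ q * φ t ≠ 0 := mul_ne_zero (pow_ne_zero _ hg0) ht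
  refine ⟨(g ^ q * φ t) ^ 3, pow_ne_zero _ hc0, fun d hd => ?_⟩
  obtain ⟨n, m, hn, hm⟩ := exists_pow_mem_iterateImage hφ (pow_ne_zero q hg0) hgq hd
  obtain ⟨k, s, hs⟩ := exists_iterate_pow_mul_eq_pow_three hq2 hφ (hφ (g ^ q) t) m
  have hmem : (g ^ q * φ t) ^ m * s ∈ iterateImage hφ d n := by
    rw [mul_pow, mul_assoc]
    exact Ideal.mul_mem_right _ _ hm
  obtain ⟨u, hu⟩ := (mem_iterateImage hφ).mp hmem
  exact ⟨k + n, by omega, u, by rw [Function.iterate_add_apply, hu, hs]⟩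
end
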